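/- For every Σ⁰₃ set A ⊆ ℕ there is an injective computable function g : ℕ → ℕ such that for all n: if n ∈ A then g n ∈ Isom(T_{Σ₃}), and if n ∉ A then g n ∈ Isom(T_{Π₃}). (That is, (Σ⁰₃, Π⁰₃) ≤₁ (Isom(T_{Σ₃}), Isom(T_{Π₃})).) -/

import Mathlib

/-- `evalCode e` is the `e`-th partial computable function, via Mathlib's
`Nat.Partrec.Code` numbering. -/
def evalCode (e : ℕ) : ℕ →. ℕ := (Denumerable.ofNat Nat.Partrec.Code e).eval

/-- A tree is a prefix-closed set of lists of naturals. -/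
def IsTree (T : Set (List ℕ)) : Prop := ∀ l ∈ T, ∀ l' : List ℕ, l' <+: l → l' ∈ T

/-- The set of lists on which the `e`-th partial computable function returns `1`. -/
def TreeOf (e : ℕ) : Set (List ℕ) :=
  {l | evalCode e (Encodable.encode l) = Part.some 1}

/-- `e` indexes a computable tree. -/
def IndexesTree (e : ℕ) : Prop :=
  (∀ l : List ℕ, evalCode e (Encodable.encode l) = Part.some 0 ∨
      evalCode e (Encodable.encode l) = Part.some 1) ∧
  IsTree (TreeOf e)

/-- Two trees are isomorphic: there is an order isomorphism between them, each ordered by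
the prefix relation. -/
def TreeIso (S T : Set (List ℕ)) : Prop :=
  ∃ π : S ≃ T, ∀ a b : S, (a : List ℕ) <+: (b : List ℕ) ↔
    ((π a : List ℕ)) <+: ((π b : List ℕ))

/-- `Isom T`: the indices of computable trees isomorphic to `T`. -/
def Isom (T : Set (List ℕ)) : Set ℕ := {e | IndexesTree e ∧ TreeIso (TreeOf e) T}
/-- `T_{Π₃}`: the tree of height 2 in which, for every `n`, infinitely many length-1 nodes
have exactly `n` children, and no length-1 node has infinitely many children. -/
def TPi3 : Set (List ℕ) :=
  {l | l = [] ∨ (∃ p : ℕ, l = [p]) ∨ ∃ p j : ℕ, j < (Nat.unpair p).1 ∧ l = [p, j]}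

/-- `T_{Σ₃}`: `T_{Π₃}` together with one extra length-1 node with infinitely many
children. -/
def TSig3 : Set (List ℕ) :=
  {l | l = [] ∨ (∃ p : ℕ, l = [p]) ∨ (∃ j : ℕ, l = [0, j]) ∨
    ∃ p j : ℕ, j < (Nat.unpair p).1 ∧ l = [p + 1, j]}

/-- `A ⊆ ℕ` is `Π⁰₃`. -/
def Pi03 (A : Set ℕ) : Prop :=
  ∃ R : ℕ → ℕ → ℕ → ℕ → Bool,
    Computable (fun p : ℕ × ℕ × ℕ × ℕ => R p.1 p.2.1 p.2.2.1 p.2.2.2) ∧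
    A = {n | ∀ x : ℕ, ∃ y : ℕ, ∀ z : ℕ, R n x y z = true}

/-- `A ⊆ ℕ` is `Σ⁰₃`. -/
def Sigma03 (A : Set ℕ) : Prop := Pi03 Aᶜ

section BoundedQuantifier

/-- Bounded universal quantification of a Boolean predicate. -/
def boundedAll (m : ℕ) (p : ℕ → Bool) : Bool :=
  Nat.rec true (fun y acc => acc && p y) m

theorem boundedAll_eq_true {m : ℕ} {p : ℕ → Bool} :
    boundedAll m p = true ↔ ∀ y < m, p y = true := by
  induction m with
  | zero => simp [boundedAll]
  | succ k ih =>
    have : boundedAll (k + 1) p = (boundedAll k p && p k) := rfl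
    rw [this, Bool.and_eq_true, ih]
    exact (Nat.forall_lt_succ_right (p := fun y => p y = true)).symm

theorem Computable.boolNot {α : Type*} [Primcodable α] {f : α → Bool} (hf : Computable f) :
    Computable fun a => !f a :=
  Primrec.not.to_comp.comp hf

theorem Computable.boolAnd {α : Type*} [Primcodable α] {f g : α → Bool}
    (hf : Computable f) (hg : Computable g) : Computable fun a => f a && g a :=
  (Primrec.and.to_comp : Computable₂ and).comp hf hg

theorem Computable.boundedAll {α : Type*} [Primcodable α] {f : α → ℕ} {p : α → ℕ → Bool}
    (hf : Computable f) (hp : Computable fun q : α × ℕ => p q.1 q.2) :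
    Computable fun a => boundedAll (f a) (p a) := by
  refine Computable.nat_rec (h := fun a q => q.2 && p a q.1) hf (Computable.const true) ?_
  exact Computable.boolAnd (Computable.snd.comp Computable.snd)
    (hp.comp (Computable.pair Computable.fst (Computable.fst.comp Computable.snd)))

end BoundedQuantifier

section TreesOfHeightTwo

/-- The tree of height two in which the length-1 nodes are all `[p]` and the children of `[p]`
are the `[p, j]` with `j ∈ D p`. -/
def treeOfChildren (D : ℕ → Set ℕ) : Set (List ℕ) :=
  {l | l = [] ∨ (∃ p, l = [p]) ∨ ∃ p j, j ∈ D p ∧ l = [p, j]}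

theorem isTree_treeOfChildren (D : ℕ → Set ℕ) : IsTree (treeOfChildren D) := by
  rintro l hl l' h
  rcases hl with rfl | ⟨p, rfl⟩ | ⟨p, j, hj, rfl⟩
  · left; simpa using h
  · rcases l' with _ | ⟨q, _ | ⟨i, l'⟩⟩ <;> simp_all [treeOfChildren]
  · rcases l' with _ | ⟨q, _ | ⟨i, _ | ⟨k, l'⟩⟩⟩ <;> simp_all [treeOfChildren]

/-- The map on lists of length at most two induced by a map on first entries and a family of
maps on second entries. -/
def mapNodes (σ : ℕ → ℕ) (a : ℕ → ℕ → ℕ) : List ℕ → List ℕ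
  | [] => []
  | [p] => [σ p]
  | p :: j :: _ => [σ p, a p j]

theorem treeIso_of_bijOn {D D' : ℕ → Set ℕ} (σ : ℕ ≃ ℕ) (a : ℕ → ℕ → ℕ)
    (ha : ∀ p, Set.BijOn (a p) (D p) (D' (σ p))) :
    TreeIso (treeOfChildren D) (treeOfChildren D') := by
  have hbij : Set.BijOn (mapNodes σ a) (treeOfChildren D) (treeOfChildren D') := by
    refine ⟨?_, ?_, ?_⟩
    · rintro l (rfl | ⟨p, rfl⟩ | ⟨p, j, hj, rfl⟩)
      · exact Or.inl rfl
      · exact Or.inr (Or.inl ⟨_, rfl⟩)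
      · exact Or.inr (Or.inr ⟨_, _, (ha p).mapsTo hj, rfl⟩)
    · rintro l (rfl | ⟨p, rfl⟩ | ⟨p, j, hj, rfl⟩) l' (rfl | ⟨q, rfl⟩ | ⟨q, i, hi, rfl⟩) h <;>
        simp [mapNodes] at h ⊢
      · exact h
      · obtain ⟨rfl, h⟩ := h
        exact ⟨rfl, (ha p).injOn hj hi h⟩
    · rintro l (rfl | ⟨p, rfl⟩ | ⟨p, j, hj, rfl⟩)
      · exact ⟨[], Or.inl rfl, rfl⟩
      · exact ⟨[σ.symm p], Or.inr (Or.inl ⟨_, rfl⟩), by simp [mapNodes]⟩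
      · obtain ⟨i, hi, rfl⟩ := (ha (σ.symm p)).surjOn (by simpa using hj)
        exact ⟨[σ.symm p, i], Or.inr (Or.inr ⟨_, _, hi, rfl⟩), by simp [mapNodes]⟩
  refine ⟨hbij.equiv, ?_⟩
  rintro ⟨l, hl⟩ ⟨l', hl'⟩
  change l <+: l' ↔ mapNodes σ a l <+: mapNodes σ a l'
  rcases hl with rfl | ⟨p, rfl⟩ | ⟨p, j, hj, rfl⟩ <;>
    rcases hl' with rfl | ⟨q, rfl⟩ | ⟨q, i, hi, rfl⟩ <;>
    simp [mapNodes, List.cons_prefix_cons]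
  rintro rfl
  exact ((ha p).injOn.eq_iff hj hi).symm

theorem exists_bijOn_of_mk_eq {s t : Set ℕ} (h : Cardinal.mk s = Cardinal.mk t) :
    ∃ a : ℕ → ℕ, Set.BijOn a s t := by
  classical
  obtain ⟨e⟩ := Cardinal.eq.1 h
  refine ⟨fun j => if hj : j ∈ s then e ⟨j, hj⟩ else 0, ?_, ?_, ?_⟩
  · intro j hj
    simp [hj]
  · intro i hi j hj hij
    simpa [hi, hj, Subtype.val_inj] using hij
  · intro j hj
    exact ⟨e.symm ⟨j, hj⟩, (e.symm ⟨j, hj⟩).2, by simp⟩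

/-- Two height-two trees are isomorphic if in both every finite number of children occurs
infinitely often, at most one node has infinitely many children, and such a node exists in one
if and only if it exists in the other. -/
theorem treeIso_of_infinite_finite_fibers {D D' : ℕ → Set ℕ}
    (hfin : ∀ k : ℕ, {p | Cardinal.mk (D p) = k}.Infinite)
    (hfin' : ∀ k : ℕ, {p | Cardinal.mk (D' p) = k}.Infinite)
    (hsub : {p | (D p).Infinite}.Subsingleton) (hsub' : {p | (D' p).Infinite}.Subsingleton)
    (hex : (∃ p, (D p).Infinite) ↔ ∃ p, (D' p).Infinite) :
    TreeIso (treeOfChildren D) (treeOfChildren D') := by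
  have key : ∀ c : Cardinal.{0},
      Nonempty ({p // Cardinal.mk (D p) = c} ≃ {p // Cardinal.mk (D' p) = c}) := by
    intro c
    rcases lt_or_ge c Cardinal.aleph0 with hc | hc
    · obtain ⟨k, rfl⟩ := Cardinal.lt_aleph0.1 hc
      have := (hfin k).to_subtype
      have := (hfin' k).to_subtype
      exact nonempty_equiv_of_countable (α := {p | Cardinal.mk (D p) = k})
        (β := {p | Cardinal.mk (D' p) = k})
    · have inf : ∀ {s : Set ℕ}, Cardinal.mk s = c → s.Infinite := fun h =>
        Set.infinite_coe_iff.1 (Cardinal.infinite_iff.2 (h ▸ hc))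
      have eq : ∀ {s t : Set ℕ}, Cardinal.mk s = c → t.Infinite → Cardinal.mk t = c := by
        intro s t hs ht
        have := (inf hs).to_subtype
        have := ht.to_subtype
        rw [← hs, Cardinal.mk_eq_aleph0, Cardinal.mk_eq_aleph0]
      have : Subsingleton {p // Cardinal.mk (D p) = c} :=
        ⟨fun p q => Subtype.ext (hsub (inf p.2) (inf q.2))⟩
      have : Subsingleton {p // Cardinal.mk (D' p) = c} :=
        ⟨fun p q => Subtype.ext (hsub' (inf p.2) (inf q.2))⟩
      have hto : ∀ p : {p // Cardinal.mk (D p) = c}, ∃ q, Cardinal.mk (D' q) = c := fun p =>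
        (hex.1 ⟨p, inf p.2⟩).imp fun q hq => eq p.2 hq
      have hfrom : ∀ p : {p // Cardinal.mk (D' p) = c}, ∃ q, Cardinal.mk (D q) = c := fun p =>
        (hex.2 ⟨p, inf p.2⟩).imp fun q hq => eq p.2 hq
      exact ⟨equivOfSubsingletonOfSubsingleton (fun p => ⟨_, (hto p).choose_spec⟩)
        (fun p => ⟨_, (hfrom p).choose_spec⟩)⟩
  let e := fun c => (key c).some
  let σ : ℕ ≃ ℕ := (Equiv.sigmaFiberEquiv fun p => Cardinal.mk (D p)).symm.trans
    ((Equiv.sigmaCongrRight e).trans (Equiv.sigmaFiberEquiv fun p => Cardinal.mk (D' p)))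
  have hσ : ∀ p, Cardinal.mk (D p) = Cardinal.mk (D' (σ p)) := fun p =>
    (e (Cardinal.mk (D p)) ⟨p, rfl⟩).2.symm
  choose a ha using fun p => exists_bijOn_of_mk_eq (hσ p)
  exact treeIso_of_bijOn σ a ha

theorem infinite_fiber_of_unpair {D : ℕ → Set ℕ} {u : ℕ → ℕ} (hu : Function.Injective u)
    (hD : ∀ p, D (u p) = Set.Iio (Nat.unpair p).1) (k : ℕ) :
    {p | Cardinal.mk (D p) = k}.Infinite := by
  refine Set.infinite_of_injective_forall_mem (f := fun i => u (Nat.pair k i)) ?_ ?_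
  · intro i j h
    exact (Nat.pair_eq_pair.1 (hu h)).2
  · intro i
    simp [hD]

/-- The children of the length-1 nodes of `TPi3`. -/
def childrenPi3 (p : ℕ) : Set ℕ := Set.Iio (Nat.unpair p).1

/-- The children of the length-1 nodes of `TSig3`. -/
def childrenSig3 : ℕ → Set ℕ
  | 0 => Set.univ
  | p + 1 => Set.Iio (Nat.unpair p).1

theorem TPi3_eq : TPi3 = treeOfChildren childrenPi3 := rfl

theorem TSig3_eq : TSig3 = treeOfChildren childrenSig3 := by
  ext l
  constructor
  · rintro (h | h | ⟨j, rfl⟩ | ⟨p, j, hj, rfl⟩)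
    · exact Or.inl h
    · exact Or.inr (Or.inl h)
    · exact Or.inr (Or.inr ⟨0, j, trivial, rfl⟩)
    · exact Or.inr (Or.inr ⟨p + 1, j, hj, rfl⟩)
  · rintro (h | h | ⟨_ | p, j, hj, rfl⟩)
    · exact Or.inl h
    · exact Or.inr (Or.inl h)
    · exact Or.inr (Or.inr (Or.inl ⟨j, rfl⟩))
    · exact Or.inr (Or.inr (Or.inr ⟨p, j, hj, rfl⟩))

theorem childrenPi3_finite (p : ℕ) : (childrenPi3 p).Finite := Set.finite_Iio _

theorem childrenSig3_infinite_iff {p : ℕ} : (childrenSig3 p).Infinite ↔ p = 0 := by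
  cases p with
  | zero => simp [childrenSig3, Set.infinite_univ]
  | succ p => simp [childrenSig3]

theorem treeIso_TPi3 {D : ℕ → Set ℕ} (hfin : ∀ k : ℕ, {p | Cardinal.mk (D p) = k}.Infinite)
    (h : ∀ p, ¬ (D p).Infinite) : TreeIso (treeOfChildren D) TPi3 := by
  rw [TPi3_eq]
  have h' : ∀ p, ¬ (childrenPi3 p).Infinite := fun p => Set.not_infinite.2 (childrenPi3_finite p)
  exact treeIso_of_infinite_finite_fibers hfin
    (infinite_fiber_of_unpair Function.injective_id fun _ => rfl)
    (fun p hp => absurd hp (h p)) (fun p hp => absurd hp (h' p))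
    ⟨fun ⟨p, hp⟩ => absurd hp (h p), fun ⟨p, hp⟩ => absurd hp (h' p)⟩

theorem treeIso_TSig3 {D : ℕ → Set ℕ} (hfin : ∀ k : ℕ, {p | Cardinal.mk (D p) = k}.Infinite)
    (hsub : {p | (D p).Infinite}.Subsingleton) (hex : ∃ p, (D p).Infinite) :
    TreeIso (treeOfChildren D) TSig3 := by
  rw [TSig3_eq]
  refine treeIso_of_infinite_finite_fibers hfin
    (infinite_fiber_of_unpair Nat.succ_injective fun _ => rfl) hsub ?_
    ⟨fun _ => ⟨0, childrenSig3_infinite_iff.2 rfl⟩, fun _ => hex⟩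
  intro p hp q hq
  rw [childrenSig3_infinite_iff.1 hp, childrenSig3_infinite_iff.1 hq]

end TreesOfHeightTwo

section Indices

/-- Uniformly computable families of height-two trees have injective computable indexings. -/
theorem exists_index_treeOfChildren {D : ℕ → ℕ → ℕ → Bool}
    (hD : Computable fun q : ℕ × ℕ × ℕ => D q.1 q.2.1 q.2.2) :
    ∃ g : ℕ → ℕ, Computable g ∧ Function.Injective g ∧ ∀ n, IndexesTree (g n) ∧
      TreeOf (g n) = treeOfChildren fun p => {j | D n p j = true} := by
  let χ : ℕ → List ℕ → Bool := fun n l =>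
    bif decide (l.length ≤ 1) then true
    else bif decide (l.length = 2) then D n (l.getD 0 0) (l.getD 1 0) else false
  have hχ : Computable fun q : ℕ × List ℕ => χ q.1 q.2 := by
    have hlen : Primrec fun q : ℕ × List ℕ => q.2.length := Primrec.list_length.comp Primrec.snd
    have hget : ∀ i, Computable fun q : ℕ × List ℕ => q.2.getD i 0 := fun i =>
      ((Primrec.list_getD 0).comp Primrec.snd (Primrec.const i)).to_comp
    refine Computable.cond ?_ (Computable.const true)
      (Computable.cond ?_ ?_ (Computable.const false))
    · exact (Primrec.nat_le.comp hlen (Primrec.const 1)).decide.to_comp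
    · exact (Primrec.eq.comp hlen (Primrec.const 2)).decide.to_comp
    · exact hD.comp (Computable.pair Computable.fst (Computable.pair (hget 0) (hget 1)))
  let F : ℕ → ℕ := fun m =>
    bif χ m.unpair.1 ((Encodable.decode (α := List ℕ) m.unpair.2).getD []) then 1 else 0
  have hF : Computable F := by
    refine Computable.cond ?_ (Computable.const 1) (Computable.const 0)
    refine hχ.comp (Computable.pair (Computable.fst.comp Computable.unpair) ?_)
    exact Computable.option_getD
      (Computable.decode.comp (Computable.snd.comp Computable.unpair)) (Computable.const [])
  obtain ⟨c, hc⟩ := Nat.Partrec.Code.exists_code.1 (Partrec.nat_iff.1 hF.partrec)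
  let g : ℕ → ℕ := fun n => Encodable.encode (Nat.Partrec.Code.curry c n)
  have hg : ∀ n l, evalCode (g n) (Encodable.encode l) = Part.some (bif χ n l then 1 else 0) := by
    intro n l
    simp [evalCode, g, Nat.Partrec.Code.eval_curry, hc, F]
  have hmem : ∀ n l, l ∈ TreeOf (g n) ↔ χ n l = true := by
    intro n l
    change evalCode (g n) (Encodable.encode l) = Part.some 1 ↔ _
    rw [hg]
    cases χ n l <;> simp
  have htree : ∀ n, TreeOf (g n) = treeOfChildren fun p => {j | D n p j = true} := by
    intro n
    ext l
    rw [hmem]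
    rcases l with _ | ⟨p, _ | ⟨j, _ | ⟨k, l⟩⟩⟩ <;> simp [χ, treeOfChildren]
  refine ⟨g, ?_, ?_, fun n => ⟨⟨fun l => ?_, ?_⟩, htree n⟩⟩
  · exact Computable.encode.comp
      (Nat.Partrec.Code.primrec₂_curry.comp (Primrec.const c) Primrec.id).to_comp
  · intro n m h
    exact (Nat.Partrec.Code.curry_inj (Encodable.encode_injective h)).2
  · rw [hg]
    cases χ n l <;> simp
  · rw [htree]
    exact isTree_treeOfChildren _

end Indices

section UniqueWitness

/-- Every `y < m` has a `z < s` at which `Q y z` fails. -/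
def failsBelow (Q : ℕ → ℕ → Bool) (m s : ℕ) : Bool :=
  boundedAll m fun y => !boundedAll s fun z => Q y z

theorem failsBelow_eq_true {Q : ℕ → ℕ → Bool} {m s : ℕ} :
    failsBelow Q m s = true ↔ ∀ y < m, ∃ z < s, Q y z = false := by
  simp [failsBelow, boundedAll_eq_true, ← Bool.not_eq_true]

/-- `j` codes a pair `(m, s)` where `s` is least such that `failsBelow Q m s`. -/
def isStage (Q : ℕ → ℕ → Bool) (j : ℕ) : Bool :=
  failsBelow Q j.unpair.1 j.unpair.2 &&
    boundedAll j.unpair.2 fun s => !failsBelow Q j.unpair.1 s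

theorem infinite_isStage_iff {Q : ℕ → ℕ → Bool} :
    {j | isStage Q j = true}.Infinite ↔ ∀ y, ∃ z, Q y z = false := by
  constructor
  · intro h
    by_contra! hy
    obtain ⟨y, hy⟩ := hy
    refine h (Set.Finite.of_finite_image (f := fun j => j.unpair.1) ?_ ?_)
    · refine (Set.finite_Iic y).subset ?_
      rintro _ ⟨j, hj, rfl⟩
      simp only [isStage, Set.mem_ofPred_eq, Bool.and_eq_true, failsBelow_eq_true] at hj
      by_contra hlt
      obtain ⟨z, -, hz⟩ := hj.1 y (by simpa using hlt)
      exact hy z hz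
    · intro i hi j hj hij
      simp only [isStage, Set.mem_ofPred_eq, Bool.and_eq_true, boundedAll_eq_true] at hi hj hij
      rw [hij] at hi
      have : i.unpair.2 = j.unpair.2 := by
        rcases lt_trichotomy i.unpair.2 j.unpair.2 with hlt | heq | hlt
        · simpa [hi.1] using hj.2 _ hlt
        · exact heq
        · simpa [hj.1] using hi.2 _ hlt
      rw [← Nat.pair_unpair i, ← Nat.pair_unpair j, hij, this]
  · intro h
    choose f hf using h
    have hex : ∀ m, ∃ s, failsBelow Q m s = true := by
      intro m
      refine ⟨(Finset.range m).sup f + 1, failsBelow_eq_true.2 fun y hy => ⟨f y, ?_, hf y⟩⟩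
      exact Nat.lt_succ_of_le (Finset.le_sup (Finset.mem_range.2 hy))
    refine Set.infinite_of_injective_forall_mem (f := fun m => Nat.pair m (Nat.find (hex m))) ?_ ?_
    · intro m k h
      exact (Nat.pair_eq_pair.1 h).1
    · intro m
      simp only [isStage, Set.mem_ofPred_eq, Nat.unpair_pair, Bool.and_eq_true, boundedAll_eq_true]
      exact ⟨Nat.find_spec (hex m), fun s hs => by simpa using Nat.find_min (hex m) hs⟩

/-- The stages `j` of `C x` at which the guess `b` for the least bound on the stages of all `C w`
with `w < x` looks correct. -/
def guardedStage (C : ℕ → ℕ → Bool) (x b j : ℕ) : Bool :=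
  C x j && (boundedAll x fun x' => boundedAll j fun t => !C x' (b + t)) &&
    !(!decide (b = 0) && boundedAll x fun x' => !C x' (b - 1))

theorem infinite_guardedStage_iff {C : ℕ → ℕ → Bool} {x b : ℕ} :
    {j | guardedStage C x b j = true}.Infinite ↔ {j | C x j = true}.Infinite ∧
      (∀ x' < x, ∀ t, C x' (b + t) = false) ∧ (b = 0 ∨ ∃ x' < x, C x' (b - 1) = true) := by
  have key : ∀ j, guardedStage C x b j = true ↔ C x j = true ∧
      (∀ x' < x, ∀ t < j, C x' (b + t) = false) ∧ (b = 0 ∨ ∃ x' < x, C x' (b - 1) = true) := by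
    intro j
    rw [guardedStage, Bool.and_eq_true, Bool.and_eq_true, boundedAll_eq_true, and_assoc]
    refine and_congr_right' (and_congr ?_ ?_)
    · simp [boundedAll_eq_true]
    · rw [Bool.not_eq_true', ← Bool.not_eq_true, Bool.and_eq_true, boundedAll_eq_true]
      by_cases hb : b = 0 <;> simp [hb]
  simp only [key]
  constructor
  · intro h
    obtain ⟨j, hj⟩ := h.nonempty
    refine ⟨h.mono fun j hj => hj.1, fun x' hx' t => ?_, hj.2.2⟩
    obtain ⟨i, hi, hti⟩ := h.exists_gt t
    exact hi.2.1 x' hx' t hti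
  · rintro ⟨h, h1, h2⟩
    exact h.mono fun j hj => ⟨hj, fun x' hx' t _ => h1 x' hx' t, h2⟩

theorem guardedStage_unique {C : ℕ → ℕ → Bool} {x b x₁ b₁ : ℕ}
    (h : {j | guardedStage C x b j = true}.Infinite)
    (h₁ : {j | guardedStage C x₁ b₁ j = true}.Infinite) : x = x₁ ∧ b = b₁ := by
  have hx_lt : ∀ {x b x₁ b₁ : ℕ}, {j | guardedStage C x b j = true}.Infinite →
      {j | guardedStage C x₁ b₁ j = true}.Infinite → ¬ x < x₁ := by
    intro x b x₁ b₁ h h₁ hlt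
    rw [infinite_guardedStage_iff] at h h₁
    obtain ⟨j, hj, hbj⟩ := h.1.exists_gt b₁
    have := h₁.2.1 x hlt (j - b₁)
    rw [Nat.add_sub_cancel' hbj.le] at this
    exact Bool.false_ne_true (this.symm.trans hj)
  have hb_lt : ∀ {x b b₁ : ℕ}, {j | guardedStage C x b j = true}.Infinite →
      {j | guardedStage C x b₁ j = true}.Infinite → ¬ b < b₁ := by
    intro x b b₁ h h₁ hlt
    rw [infinite_guardedStage_iff] at h h₁
    rcases h₁.2.2 with h0 | ⟨x', hx', hC⟩
    · omega
    · have := h.2.1 x' hx' (b₁ - 1 - b)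
      rw [Nat.add_sub_cancel' (by omega)] at this
      exact Bool.false_ne_true (this.symm.trans hC)
  obtain rfl : x = x₁ := le_antisymm (not_lt.1 (hx_lt h₁ h)) (not_lt.1 (hx_lt h h₁))
  exact ⟨rfl, le_antisymm (not_lt.1 (hb_lt h₁ h)) (not_lt.1 (hb_lt h h₁))⟩

theorem exists_infinite_guardedStage_iff {C : ℕ → ℕ → Bool} :
    (∃ x b, {j | guardedStage C x b j = true}.Infinite) ↔ ∃ x, {j | C x j = true}.Infinite := by
  classical
  constructor
  · rintro ⟨x, b, h⟩
    exact ⟨x, (infinite_guardedStage_iff.1 h).1⟩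
  · intro h
    have hmin : ∀ x' < Nat.find h, {j | C x' j = true}.Finite := fun x' hx' =>
      Set.not_infinite.1 (Nat.find_min h hx')
    have hb : ∃ b, ∀ x' < Nat.find h, ∀ t, C x' (b + t) = false := by
      obtain ⟨b, hb⟩ := ((Set.finite_Iio (Nat.find h)).biUnion hmin).bddAbove
      refine ⟨b + 1, fun x' hx' t => ?_⟩
      by_contra hC
      have : b + 1 + t ≤ b := hb (Set.mem_biUnion hx' (by simpa using hC))
      omega
    refine ⟨Nat.find h, Nat.find hb,
      infinite_guardedStage_iff.2 ⟨Nat.find_spec h, Nat.find_spec hb, ?_⟩⟩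
    rcases Nat.eq_zero_or_pos (Nat.find hb) with h0 | hpos
    · exact Or.inl h0
    · have := Nat.find_min hb (Nat.sub_lt hpos one_pos)
      push Not at this
      obtain ⟨x', hx', t, ht⟩ := this
      refine Or.inr ⟨x', hx', ?_⟩
      rcases t with _ | t
      · simpa using ht
      · have := Nat.find_spec hb x' hx' t
        rw [show Nat.find hb - 1 + (t + 1) = Nat.find hb + t by omega] at ht
        exact absurd this ht

end UniqueWitness

section Construction

/-- Even nodes provide infinitely many nodes of each finite branching; the odd nodes test the
possible witnesses for `∃ x, ∀ y, ∃ z, Q x y z = false`. -/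
def witnessChildren (Q : ℕ → ℕ → ℕ → Bool) (p j : ℕ) : Bool :=
  bif p.bodd then guardedStage (fun x => isStage (Q x)) p.div2.unpair.1 p.div2.unpair.2 j
  else decide (j < p.div2.unpair.1)

theorem witnessChildren_finite_fiber (Q : ℕ → ℕ → ℕ → Bool) (k : ℕ) :
    {p | Cardinal.mk {j | witnessChildren Q p j = true} = k}.Infinite := by
  refine infinite_fiber_of_unpair (D := fun p => {j | witnessChildren Q p j = true})
    (u := fun p => 2 * p) (fun p q h => by simpa using h) (fun p => ?_) k
  ext j
  simp [witnessChildren, Nat.div2_val]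

theorem infinite_witnessChildren_iff {Q : ℕ → ℕ → ℕ → Bool} {p : ℕ} :
    {j | witnessChildren Q p j = true}.Infinite ↔ p.bodd = true ∧
      {j | guardedStage (fun x => isStage (Q x)) p.div2.unpair.1 p.div2.unpair.2 j = true}.Infinite
    := by
  cases h : p.bodd
  · simpa [witnessChildren, h] using Set.finite_lt_nat _
  · simp [witnessChildren, h]

theorem witnessChildren_subsingleton (Q : ℕ → ℕ → ℕ → Bool) :
    {p | {j | witnessChildren Q p j = true}.Infinite}.Subsingleton := by
  intro p hp q hq
  rw [Set.mem_ofPred_eq, infinite_witnessChildren_iff] at hp hq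
  obtain ⟨h1, h2⟩ := guardedStage_unique hp.2 hq.2
  have : p.div2 = q.div2 := by rw [← Nat.pair_unpair p.div2, h1, h2, Nat.pair_unpair]
  rw [← Nat.bit_bodd_div2 p, ← Nat.bit_bodd_div2 q, hp.1, hq.1, this]

theorem exists_infinite_witnessChildren_iff {Q : ℕ → ℕ → ℕ → Bool} :
    (∃ p, {j | witnessChildren Q p j = true}.Infinite) ↔ ∃ x, ∀ y, ∃ z, Q x y z = false := by
  simp only [← infinite_isStage_iff]
  rw [← exists_infinite_guardedStage_iff (C := fun x => isStage (Q x))]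
  constructor
  · rintro ⟨p, hp⟩
    exact ⟨_, _, (infinite_witnessChildren_iff.1 hp).2⟩
  · rintro ⟨x, b, h⟩
    refine ⟨2 * Nat.pair x b + 1, infinite_witnessChildren_iff.2 ⟨by simp, ?_⟩⟩
    simpa [Nat.div2_val, Nat.mul_add_div] using h

section Computability

variable {α : Type*} [Primcodable α]

theorem computable_failsBelow {Q : α → ℕ → ℕ → Bool}
    (hQ : Computable fun q : α × ℕ × ℕ => Q q.1 q.2.1 q.2.2) {m s : α → ℕ}
    (hm : Computable m) (hs : Computable s) :
    Computable fun a => failsBelow (Q a) (m a) (s a) := by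
  refine Computable.boundedAll hm (Computable.boolNot ?_)
  refine Computable.boundedAll (p := fun (q : α × ℕ) z => Q q.1 q.2 z)
    (hs.comp Computable.fst) ?_
  exact hQ.comp (Computable.pair (Computable.fst.comp Computable.fst)
    (Computable.pair (Computable.snd.comp Computable.fst) Computable.snd))

theorem computable_isStage {Q : α → ℕ → ℕ → Bool}
    (hQ : Computable fun q : α × ℕ × ℕ => Q q.1 q.2.1 q.2.2) {j : α → ℕ} (hj : Computable j) :
    Computable fun a => isStage (Q a) (j a) := by
  have h1 : Computable fun a => (j a).unpair.1 := Computable.fst.comp (Computable.unpair.comp hj)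
  have h2 : Computable fun a => (j a).unpair.2 := Computable.snd.comp (Computable.unpair.comp hj)
  refine Computable.boolAnd (computable_failsBelow hQ h1 h2)
    (Computable.boundedAll h2 (Computable.boolNot ?_))
  refine computable_failsBelow (Q := fun q : α × ℕ => Q q.1) ?_
    (h1.comp Computable.fst) Computable.snd
  exact hQ.comp (Computable.pair (Computable.fst.comp Computable.fst) Computable.snd)

theorem computable_guardedStage {C : α → ℕ → ℕ → Bool}
    (hC : Computable fun q : α × ℕ × ℕ => C q.1 q.2.1 q.2.2) {x b j : α → ℕ}
    (hx : Computable x) (hb : Computable b) (hj : Computable j) :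
    Computable fun a => guardedStage (C a) (x a) (b a) (j a) := by
  refine Computable.boolAnd (Computable.boolAnd ?_ ?_)
    (Computable.boolNot (Computable.boolAnd (Computable.boolNot ?_) ?_))
  · exact hC.comp (Computable.pair Computable.id (Computable.pair hx hj))
  · refine Computable.boundedAll hx ?_
    refine Computable.boundedAll (p := fun (q : α × ℕ) t => !C q.1 q.2 (b q.1 + t))
      (hj.comp Computable.fst) (Computable.boolNot ?_)
    have hsum : Computable fun r : (α × ℕ) × ℕ => b r.1.1 + r.2 :=
      Primrec.nat_add.to_comp.comp (hb.comp (Computable.fst.comp Computable.fst)) Computable.snd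
    exact hC.comp (Computable.pair (Computable.fst.comp Computable.fst)
      (Computable.pair (Computable.snd.comp Computable.fst) hsum))
  · exact (Primrec.eq.comp Primrec.id (Primrec.const 0)).decide.to_comp.comp hb
  · refine Computable.boundedAll hx (Computable.boolNot ?_)
    have hpred : Computable fun r : α × ℕ => b r.1 - 1 :=
      (Primrec.nat_sub.comp Primrec.id (Primrec.const 1)).to_comp.comp (hb.comp Computable.fst)
    exact hC.comp (Computable.pair Computable.fst (Computable.pair Computable.snd hpred))

theorem computable_witnessChildren {Q : α → ℕ → ℕ → ℕ → Bool}
    (hQ : Computable fun q : α × ℕ × ℕ × ℕ => Q q.1 q.2.1 q.2.2.1 q.2.2.2) :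
    Computable fun q : α × ℕ × ℕ => witnessChildren (Q q.1) q.2.1 q.2.2 := by
  have hp : Computable fun q : α × ℕ × ℕ => q.2.1 := Computable.fst.comp Computable.snd
  have hj : Computable fun q : α × ℕ × ℕ => q.2.2 := Computable.snd.comp Computable.snd
  have hv : Computable fun q : α × ℕ × ℕ => q.2.1.div2.unpair :=
    Computable.unpair.comp (Computable.nat_div2.comp hp)
  have hx : Computable fun q : α × ℕ × ℕ => q.2.1.div2.unpair.1 := Computable.fst.comp hv
  have hb : Computable fun q : α × ℕ × ℕ => q.2.1.div2.unpair.2 := Computable.snd.comp hv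
  have hstage : Computable fun r : α × ℕ × ℕ => isStage (Q r.1 r.2.1) r.2.2 := by
    refine computable_isStage (Q := fun r : α × ℕ × ℕ => Q r.1 r.2.1) ?_
      (Computable.snd.comp Computable.snd)
    exact hQ.comp (Computable.pair (Computable.fst.comp Computable.fst)
      (Computable.pair (Computable.fst.comp (Computable.snd.comp Computable.fst)) Computable.snd))
  have hguard : Computable fun q : α × ℕ × ℕ =>
      guardedStage (fun x => isStage (Q q.1 x)) q.2.1.div2.unpair.1 q.2.1.div2.unpair.2 q.2.2 := by
    refine computable_guardedStage (C := fun (q : α × ℕ × ℕ) x => isStage (Q q.1 x))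
      (x := fun q => q.2.1.div2.unpair.1) (b := fun q => q.2.1.div2.unpair.2)
      (j := fun q => q.2.2) ?_ hx hb hj
    have hproj : Computable fun r : (α × ℕ × ℕ) × ℕ × ℕ => (r.1.1, r.2) :=
      Computable.pair (Computable.fst.comp Computable.fst) Computable.snd
    exact (hstage.comp hproj :)
  have hlt : Computable fun r : ℕ × ℕ => decide (r.1 < r.2) :=
    (Primrec.nat_lt.comp Primrec.fst Primrec.snd).decide.to_comp
  have hdecide : Computable fun q : α × ℕ × ℕ => decide (q.2.2 < q.2.1.div2.unpair.1) :=
    hlt.comp (Computable.pair hj hx)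
  exact Computable.cond (Computable.nat_bodd.comp hp) hguard hdecide

end Computability

end Construction

/-- `(Σ⁰₃, Π⁰₃) ≤₁ (Isom(T_{Σ₃}), Isom(T_{Π₃}))`. -/
theorem sigma03_one_one_reducible_to_isom (A : Set ℕ) (hA : Sigma03 A) :
    ∃ g : ℕ → ℕ, Computable g ∧ Function.Injective g ∧
      ∀ n : ℕ, (n ∈ A → g n ∈ Isom TSig3) ∧ (n ∉ A → g n ∈ Isom TPi3) := by
  obtain ⟨R, hR, hAR⟩ := hA
  obtain ⟨g, hg, hinj, hidx⟩ := exists_index_treeOfChildren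
    (D := fun n => witnessChildren (R n)) (computable_witnessChildren (Q := R) hR)
  have hmem : ∀ n, n ∈ A ↔ ∃ p, {j | witnessChildren (R n) p j = true}.Infinite := by
    intro n
    rw [exists_infinite_witnessChildren_iff, ← not_iff_not, ← Set.mem_compl_iff, hAR]
    simp
  refine ⟨g, hg, hinj, fun n => ⟨fun hn => ⟨(hidx n).1, ?_⟩, fun hn => ⟨(hidx n).1, ?_⟩⟩⟩
  · rw [(hidx n).2]
    exact treeIso_TSig3 (witnessChildren_finite_fiber (R n)) (witnessChildren_subsingleton (R n))
      ((hmem n).1 hn)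
  · rw [(hidx n).2]
    exact treeIso_TPi3 (witnessChildren_finite_fiber (R n)) fun p hp => hn ((hmem n).2 ⟨p, hp⟩)
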